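/- Let k ≥ 3 and n ≥ k−1. Then C_k(n, k−1) = C_k(n−1, k−1) + A_{k−2}(n−3, k−2) + A_{k−1}(n−3, k−2). -/

import Mathlib

/-- A permutation `α` of `{1,…,n}` (as `Equiv.Perm (Fin n)`, 0-indexed) contains the
pattern given in one-line notation by the list `w`: there are increasing positions
whose values are order-isomorphic to `w`. -/
def ContainsPattern {n : ℕ} (α : Equiv.Perm (Fin n)) (w : List ℕ) : Prop :=
  ∃ f : Fin w.length → Fin n, StrictMono f ∧
    ∀ a b : Fin w.length, w.get a < w.get b ↔ α (f a) < α (f b)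

/-- `α` avoids the pattern `w`. -/
def AvoidsPattern {n : ℕ} (α : Equiv.Perm (Fin n)) (w : List ℕ) : Prop :=
  ¬ ContainsPattern α w

/-- The pattern of length `2k` (in one-line notation, on values `1,…,2k`) beginning with
`a, k+2, k+3, …, 2k−1`, followed by `1, 2k` (if `sep = true`) or by `2k` (if `sep = false`),
and ending with the remaining elements of `{1,…,2k}` in increasing order. -/
def gonPattern (k a : ℕ) (sep : Bool) : List ℕ :=
  let pre : List ℕ := a :: (List.range' (k+2) (k-2) ++ (if sep then [1, 2*k] else [2*k]))
  pre ++ ((List.range' 1 (2*k)).filter (fun x => !(pre.contains x)))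

/-- `π` is a 321-`k`-gon-avoiding permutation: it avoids `321` and the four
patterns of `𝔓_k`. -/
def Avoids321Gon (k : ℕ) {n : ℕ} (π : Equiv.Perm (Fin n)) : Prop :=
  AvoidsPattern π [3, 2, 1] ∧
    AvoidsPattern π (gonPattern k k true) ∧ AvoidsPattern π (gonPattern k k false) ∧
    AvoidsPattern π (gonPattern k (k+1) true) ∧ AvoidsPattern π (gonPattern k (k+1) false)

/-- `f_k(n)`: the number of 321-`k`-gon-avoiding permutations of `{1,…,n}`. -/
noncomputable def fgon (k n : ℕ) : ℕ :=
  Nat.card {π : Equiv.Perm (Fin n) // Avoids321Gon k π}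

/-- `π` starts (in one-line notation on values `1,…,n`) with the entries listed in `l`,
i.e. `π(1) = l₁, π(2) = l₂, …`. -/
def StartsWith {n : ℕ} (π : Equiv.Perm (Fin n)) (l : List ℕ) : Prop :=
  ∀ (j : Fin l.length) (hj : (j : ℕ) < n), ((π ⟨j, hj⟩ : Fin n) : ℕ) + 1 = l.get j

/-- `f_k(n; i₁,…,i_m)`: the number of 321-`k`-gon-avoiding permutations of `{1,…,n}`
starting with `i₁ i₂ ⋯ i_m` (given as the list `l`). -/
noncomputable def fstart (k n : ℕ) (l : List ℕ) : ℕ :=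
  Nat.card {π : Equiv.Perm (Fin n) // Avoids321Gon k π ∧ StartsWith π l}

/-- `A_d(n,m) = Σ_{d ≤ i₁ < ⋯ < i_m ≤ n} f_k(n; i₁,…,i_m)`. -/
noncomputable def Aseq (k d n m : ℕ) : ℕ :=
  ∑ s ∈ (Finset.Icc d n).powersetCard m, fstart k n (s.sort (· ≤ ·))

/-- `B_d(n,m) = Σ_{d+1 ≤ i₁ < ⋯ < i_m ≤ n} f_k(n; d, i₁,…,i_m)`. -/
noncomputable def Bseq (k d n m : ℕ) : ℕ :=
  ∑ s ∈ (Finset.Icc (d+1) n).powersetCard m, fstart k n (d :: s.sort (· ≤ ·))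

/-- `C_d(n,m) = Σ_{d ≤ i₁ < ⋯ < i_m ≤ n} f_k(n; i₁,…,i_m, 1)`. -/
noncomputable def Cseq (k d n m : ℕ) : ℕ :=
  ∑ s ∈ (Finset.Icc d n).powersetCard m, fstart k n (s.sort (· ≤ ·) ++ [1])

/-- `L_n^k(s) = Σ_{j=0}^{s} (−1)^j C(s−j, j) f_k(n−j)`. -/
noncomputable def Lgon (k n s : ℕ) : ℤ :=
  ∑ j ∈ Finset.range (s+1), (-1 : ℤ)^j * ((s-j).choose j : ℤ) * (fgon k (n-j) : ℤ)


open Equiv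

/-- One-line notation of a permutation of `Fin n` as a function on `ℕ`, extended by the identity. -/
def lineFun {n : ℕ} (π : Perm (Fin n)) (i : ℕ) : ℕ := if h : i < n then π ⟨i, h⟩ else i

/-- `h` restricts to a permutation of `{0,…,n-1}`. -/
structure IsLine (n : ℕ) (h : ℕ → ℕ) : Prop where
  inj : Function.Injective h
  lt : ∀ i < n, h i < n
  surj : ∀ v < n, ∃ i < n, h i = v

lemma isLine_lineFun {n : ℕ} (π : Perm (Fin n)) : IsLine n (lineFun π) := by
  refine ⟨fun i j hij => ?_, fun i hi => ?_, fun v hv => ?_⟩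
  · unfold lineFun at hij
    split_ifs at hij with h1 h2 h2
    · simpa using π.injective (Fin.ext hij)
    · have := (π ⟨i, h1⟩).isLt; omega
    · have := (π ⟨j, h2⟩).isLt; omega
    · exact hij
  · simp [lineFun, hi]
  · exact ⟨π.symm ⟨v, hv⟩, (π.symm ⟨v, hv⟩).isLt, by simp [lineFun]⟩

/-- `g` is an occurrence of the pattern `w` among the first `n` entries of `h`. -/
structure Occ (h : ℕ → ℕ) (n : ℕ) (w : List ℕ) (g : Fin w.length → ℕ) : Prop where
  mono : StrictMono g
  lt : ∀ a, g a < n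
  iso : ∀ a b, w.get a < w.get b ↔ h (g a) < h (g b)

lemma containsPattern_iff {n : ℕ} (π : Perm (Fin n)) (w : List ℕ) :
    ContainsPattern π w ↔ ∃ g, Occ (lineFun π) n w g := by
  constructor
  · rintro ⟨f, hf, hiso⟩
    refine ⟨fun a => f a, fun a b hab => hf hab, fun a => (f a).isLt, fun a b => ?_⟩
    rw [hiso]; simp [lineFun]
  · rintro ⟨g, hg, hlt, hiso⟩
    refine ⟨fun a => ⟨g a, hlt a⟩, fun a b hab => hg hab, fun a b => ?_⟩
    rw [hiso]; simp [lineFun, hlt]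

/-- The value `v` after the value `q` has been inserted. -/
def bump (q v : ℕ) : ℕ := if v < q then v else v + 1

/-- Insert the value `q` at position `p`. -/
def insertLine (p q : ℕ) (h : ℕ → ℕ) (i : ℕ) : ℕ :=
  if i < p then bump q (h i) else if i = p then q else bump q (h (i - 1))

/-- Insert the value `q` at position `p` of a permutation. -/
def insertPerm {n : ℕ} (p q : Fin (n + 1)) : Perm (Fin n) ≃ {π : Perm (Fin (n + 1)) // π p = q} where
  toFun σ := ⟨(finSuccEquiv' p).trans ((optionCongr σ).trans (finSuccEquiv' q).symm), by simp⟩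
  invFun π := removeNone ((finSuccEquiv' p).symm.trans (π.1.trans (finSuccEquiv' q)))
  left_inv σ := by
    have : (finSuccEquiv' p).symm.trans (((finSuccEquiv' p).trans
        ((optionCongr σ).trans (finSuccEquiv' q).symm)).trans (finSuccEquiv' q)) =
        optionCongr σ := by ext; simp
    simp only [this, removeNone_optionCongr]
  right_inv π := by
    ext1
    simp only
    rw [map_equiv_removeNone]
    ext i
    simp [π.2]

lemma lineFun_insertPerm {n : ℕ} (p q : Fin (n + 1)) (σ : Perm (Fin n)) :
    lineFun (insertPerm p q σ).1 = insertLine p q (lineFun σ) := by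
  funext i
  by_cases hi : i < n + 1
  · have hl : lineFun (insertPerm p q σ).1 i = (insertPerm p q σ).1 ⟨i, hi⟩ := by simp [lineFun, hi]
    rw [hl]
    rcases Fin.eq_self_or_eq_succAbove p ⟨i, hi⟩ with h | ⟨j, hj⟩
    · have : i = p := by simpa [Fin.ext_iff] using h
      subst this
      simp [insertLine, (insertPerm p q σ).2]
    · have hv : (insertPerm p q σ).1 ⟨i, hi⟩ = q.succAbove (σ j) := by
        rw [hj]; simp [insertPerm]
      have hj' : i = if (j : ℕ) < p then (j : ℕ) else j + 1 := by
        have := congrArg Fin.val hj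
        simpa [Fin.succAbove, Fin.lt_def, apply_ite Fin.val] using this
      have hs : lineFun σ j = σ j := by simp [lineFun]
      rw [hv]
      have hq : ((q.succAbove (σ j) : Fin (n + 1)) : ℕ) = bump q (σ j) := by
        simp [Fin.succAbove, Fin.lt_def, apply_ite Fin.val, bump]
      rw [hq, ← hs]
      unfold insertLine
      grind
  · have := p.isLt
    have := q.isLt
    grind [lineFun, insertLine, bump]

/-- Number of permutations of `{0,…,n-1}` whose one-line notation satisfies `P`. -/
noncomputable def countLine (n : ℕ) (P : (ℕ → ℕ) → Prop) : ℕ :=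
  Nat.card {π : Perm (Fin n) // P (lineFun π)}

lemma countLine_congr {n : ℕ} {P Q : (ℕ → ℕ) → Prop} (h : ∀ f, IsLine n f → (P f ↔ Q f)) :
    countLine n P = countLine n Q :=
  Nat.card_congr (Equiv.subtypeEquivRight fun π => h _ (isLine_lineFun π))

lemma countLine_split (n : ℕ) (P Q : (ℕ → ℕ) → Prop) :
    countLine n P = countLine n (fun f => P f ∧ Q f) + countLine n (fun f => P f ∧ ¬ Q f) := by
  classical
  simp only [countLine, Nat.card_eq_fintype_card, Fintype.card_subtype, ← Finset.filter_filter]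
  exact (Finset.card_filter_add_card_filter_not _).symm

lemma countLine_insert {n p q : ℕ} (hp : p ≤ n) (hq : q ≤ n) {P : (ℕ → ℕ) → Prop}
    (hP : ∀ f, P f → f p = q) :
    countLine (n + 1) P = countLine n (fun f => P (insertLine p q f)) := by
  symm
  let p' : Fin (n + 1) := ⟨p, by omega⟩
  let q' : Fin (n + 1) := ⟨q, by omega⟩
  refine Nat.card_congr (((insertPerm p' q').subtypeEquiv
    (q := fun π => P (lineFun π.1)) fun σ => ?_).trans
      (Equiv.subtypeSubtypeEquivSubtype (q := fun π => P (lineFun π)) fun {π} h => ?_))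
  · rw [lineFun_insertPerm]
  · have := hP _ h
    simp only [lineFun, show p < n + 1 by omega, dite_true] at this
    exact Fin.ext this

lemma isLine_insertLine {n p q : ℕ} (hp : p ≤ n) (hq : q ≤ n) {h : ℕ → ℕ} (hh : IsLine n h) :
    IsLine (n + 1) (insertLine p q h) := by
  obtain ⟨h1, h2, h3⟩ := hh
  refine ⟨fun i j hij => ?_, fun i hi => ?_, fun v hv => ?_⟩
  · have a1 := @h1 i j
    have a2 := @h1 (i - 1) j
    have a3 := @h1 i (j - 1)
    have a4 := @h1 (i - 1) (j - 1)
    unfold insertLine bump at hij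
    clear h1 h2 h3
    split_ifs at hij <;> omega
  · have := h2 i
    have := h2 (i - 1)
    clear h1 h2 h3
    unfold insertLine bump
    split_ifs <;> omega
  · rcases lt_trichotomy v q with hvq | hvq | hvq
    · obtain ⟨i, hi, rfl⟩ := h3 v (by omega)
      refine ⟨bump p i, ?_, ?_⟩ <;> clear h1 h2 h3 <;> grind [insertLine, bump]
    · exact ⟨p, by omega, by simp [insertLine, hvq]⟩
    · obtain ⟨i, hi, hiv⟩ := h3 (v - 1) (by omega)
      refine ⟨bump p i, ?_, ?_⟩ <;> clear h1 h2 h3 <;> grind [insertLine, bump]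

lemma exists_occ_insertLine_iff {n p q : ℕ} (hp : p ≤ n) {h : ℕ → ℕ} {w : List ℕ}
    (H : ∀ g, Occ (insertLine p q h) (n + 1) w g →
      ∃ g, Occ (insertLine p q h) (n + 1) w g ∧ ∀ a, g a ≠ p) :
    (∃ g, Occ (insertLine p q h) (n + 1) w g) ↔ ∃ g, Occ h n w g := by
  have key : ∀ i, insertLine p q h (bump p i) = bump q (h i) := by
    intro i; grind [insertLine, bump]
  have hb : ∀ q u v, bump q u < bump q v ↔ u < v := by
    intro q u v; unfold bump; grind
  constructor
  · rintro ⟨g, hg⟩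
    obtain ⟨g, hg, hne⟩ := H g hg
    have hex : ∀ a, ∃ i, bump p i = g a := fun a => by
      refine ⟨if g a < p then g a else g a - 1, ?_⟩
      have := hne a
      grind [bump]
    choose g' hg' using hex
    refine ⟨g', fun a b hab => ?_, fun a => ?_, fun a b => ?_⟩
    · rw [← hb p, hg', hg']; exact hg.mono hab
    · have := hg.lt a
      rw [← hg'] at this
      unfold bump at this; grind
    · rw [hg.iso, ← hg', ← hg', key, key, hb]
  · rintro ⟨g, hg⟩
    refine ⟨fun a => bump p (g a), fun a b hab => ?_, fun a => ?_, fun a b => ?_⟩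
    · rw [hb]; exact hg.mono hab
    · have := hg.lt a
      unfold bump; grind
    · rw [hg.iso, key, key, hb]


/-- The properties shared by the four patterns of `𝔓_k` that matter below. -/
structure IsGon (k : ℕ) (w : List ℕ) : Prop where
  head : w[0]? = some k ∨ w[0]? = some (k + 1)
  second : w[1]? = some (k + 2)
  initial : ∀ b v, b < k - 1 → w[b]? = some v → k ≤ v
  top : ∀ v, w[k - 1]? = some v → v ≤ 1 → w[k]? = some (2 * k)
  mem : ∀ v, 1 ≤ v → v ≤ 2 * k → v ∈ w

lemma isGon_gonPattern {k a : ℕ} (hk : 3 ≤ k) (ha : a = k ∨ a = k + 1) (sep : Bool) :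
    IsGon k (gonPattern k a sep) := by
  obtain ⟨K, rfl⟩ : ∃ K, k = K + 3 := ⟨k - 3, by omega⟩
  unfold gonPattern
  constructor
  · rcases ha with rfl | rfl <;> simp
  · simp [List.range'_succ, show K + 3 - 2 = K + 1 by omega]
  · intro b v hb hv
    rcases b with _ | b
    · simp at hv; omega
    · simp [List.getElem?_append, show K + 3 - 2 = K + 1 by omega,
        show b < K + 1 by omega] at hv
      omega
  · intro v hv h1
    cases sep
    · simp [show K + 3 - 2 = K + 1 by omega] at hv
      omega
    · simp [List.getElem?_append, show K + 3 - 2 = K + 1 by omega]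
  · intro v h1 h2
    simp only [List.mem_append, List.mem_filter, List.mem_range'_1]
    by_cases h : v ∈ a :: (List.range' (K + 3 + 2) (K + 3 - 2) ++ if sep then [1, 2 * (K + 3)] else [2 * (K + 3)])
    · exact Or.inl h
    · right
      refine ⟨by omega, ?_⟩
      simp at h ⊢
      exact ⟨h.1, by omega, h.2.2⟩

lemma gonPattern_succ (K : ℕ) : gonPattern (K + 3) (K + 4) true =
    List.range' (K + 4) (K + 2) ++ [1, 2 * K + 6] ++ List.range' 2 (K + 2) := by
  unfold gonPattern
  have h : (List.range' 1 (2 * (K + 3))).filter (fun x => !((K + 4) ::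
      (List.range' (K + 3 + 2) (K + 3 - 2) ++ [1, 2 * (K + 3)])).contains x) =
      List.range' 2 (K + 2) := by
    refine List.Perm.eq_of_pairwise (le := (· < ·)) (fun a b _ _ h h' => by omega)
      (List.Pairwise.filter _ List.pairwise_lt_range') List.pairwise_lt_range' ?_
    rw [List.perm_ext_iff_of_nodup (List.Nodup.filter _ List.nodup_range') List.nodup_range']
    intro v
    simp
    omega
  simp only [if_true] at h ⊢
  rw [h]
  simp [List.range'_succ, show 2 * (K + 3) = 2 * K + 6 by omega]

lemma gonPattern_self (K : ℕ) : gonPattern (K + 3) (K + 3) true =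
    (K + 3) :: List.range' (K + 5) (K + 1) ++ [1, 2 * K + 6] ++ List.range' 2 (K + 1) ++ [K + 4] := by
  unfold gonPattern
  have h : (List.range' 1 (2 * (K + 3))).filter (fun x => !((K + 3) ::
      (List.range' (K + 3 + 2) (K + 3 - 2) ++ [1, 2 * (K + 3)])).contains x) =
      List.range' 2 (K + 1) ++ [K + 4] := by
    have hp : (List.range' 2 (K + 1) ++ [K + 4]).Pairwise (· < ·) := by
      refine List.pairwise_append.2 ⟨List.pairwise_lt_range', List.pairwise_singleton _ _, ?_⟩
      simp only [List.mem_range'_1, List.mem_singleton]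
      omega
    refine List.Perm.eq_of_pairwise (le := (· < ·)) (fun a b _ _ h h' => by omega)
      (List.Pairwise.filter _ List.pairwise_lt_range') hp ?_
    rw [List.perm_ext_iff_of_nodup (List.Nodup.filter _ List.nodup_range') hp.nodup]
    intro v
    simp
    omega
  simp only [if_true] at h ⊢
  rw [h]
  simp [show 2 * (K + 3) = 2 * K + 6 by omega]

/-- The forbidden patterns. -/
def forbidden (k : ℕ) : List (List ℕ) :=
  [[3, 2, 1], gonPattern k k true, gonPattern k k false,
    gonPattern k (k + 1) true, gonPattern k (k + 1) false]

/-- No forbidden pattern occurs among the first `n` entries of `h`. -/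
def AvoidsLine (k n : ℕ) (h : ℕ → ℕ) : Prop := ∀ w ∈ forbidden k, ¬ ∃ g, Occ h n w g

lemma avoids321Gon_iff (k : ℕ) {n : ℕ} (π : Perm (Fin n)) :
    Avoids321Gon k π ↔ AvoidsLine k n (lineFun π) := by
  simp [Avoids321Gon, AvoidsPattern, containsPattern_iff, AvoidsLine, forbidden]

lemma eq_or_isGon_of_mem_forbidden {k : ℕ} (hk : 3 ≤ k) {w : List ℕ} (hw : w ∈ forbidden k) :
    w = [3, 2, 1] ∨ IsGon k w := by
  simp only [forbidden, List.mem_cons, List.not_mem_nil, or_false] at hw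
  rcases hw with rfl | rfl | rfl | rfl | rfl
  · exact Or.inl rfl
  all_goals exact Or.inr (isGon_gonPattern hk (by simp) _)

/-- An occurrence of `321` at positions `x < y < z`. -/
lemma exists_occ_321_iff {h : ℕ → ℕ} {n : ℕ} (P : ℕ → Prop) :
    (∃ g, Occ h n [3, 2, 1] g ∧ ∀ a, P (g a)) ↔
      ∃ x y z, x < y ∧ y < z ∧ z < n ∧ h z < h y ∧ h y < h x ∧ P x ∧ P y ∧ P z := by
  constructor
  · rintro ⟨g, hg, hP⟩
    refine ⟨g (0 : Fin 3), g (1 : Fin 3), g (2 : Fin 3), hg.mono (show (0 : Fin 3) < 1 by decide),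
      hg.mono (show (1 : Fin 3) < 2 by decide), hg.lt _, ?_, ?_, hP _, hP _, hP _⟩
    · rw [← hg.iso]; decide
    · rw [← hg.iso]; decide
  · rintro ⟨x, y, z, h1, h2, h3, h4, h5, h6, h7, h8⟩
    refine ⟨![x, y, z], ⟨?_, ?_, ?_⟩, ?_⟩
    · intro (a : Fin 3) (b : Fin 3) hab
      fin_cases a <;> fin_cases b <;> simp at hab ⊢ <;> omega
    · intro (a : Fin 3)
      fin_cases a <;> simp <;> omega
    · intro (a : Fin 3) (b : Fin 3)
      fin_cases a <;> fin_cases b <;> simp <;> omega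
    · intro (a : Fin 3)
      fin_cases a <;> simpa

lemma AvoidsLine.not_321 {k n : ℕ} {h : ℕ → ℕ} (hh : AvoidsLine k n h) {x y z : ℕ}
    (hxy : x < y) (hyz : y < z) (hz : z < n) (hzy : h z < h y) : ¬ h y < h x := by
  intro hyx
  obtain ⟨g, hg, -⟩ := (exists_occ_321_iff (h := h) (n := n) (fun _ => True)).2
    ⟨x, y, z, hxy, hyz, hz, hzy, hyx, trivial, trivial, trivial⟩
  exact hh _ (by simp [forbidden]) ⟨g, hg⟩

lemma add_le_of_strictMono {m : ℕ} {g : Fin m → ℕ} (hg : StrictMono g) {a b : Fin m}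
    (hab : a ≤ b) : g a + (b - a) ≤ g b := by
  obtain ⟨b, hb⟩ := b
  induction b with
  | zero =>
    have : a = ⟨0, hb⟩ := Fin.ext (by simpa using Fin.le_def.1 hab)
    simp [this]
  | succ b ih =>
    rcases eq_or_lt_of_le hab with h | h
    · simp [h]
    · have h1 := ih (by omega) (Fin.le_def.2 (Nat.lt_succ_iff.1 (Fin.lt_def.1 h)))
      have h2 := hg (show (⟨b, by omega⟩ : Fin m) < ⟨b + 1, hb⟩ by simp)
      have h3 := Fin.lt_def.1 h
      simp only at *
      omega

lemma le_of_strictMono {m : ℕ} {g : Fin m → ℕ} (hg : StrictMono g) (a : Fin m) : (a : ℕ) ≤ g a := by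
  have := add_le_of_strictMono hg (show ⟨0, by have := a.isLt; omega⟩ ≤ a from Fin.le_def.2 (by simp))
  simp only at this
  omega

/-- In an occurrence of a `k`-gon, the smallest value comes after `k - 1` others. -/
lemma IsGon.le_of_zero {k n : ℕ} {h : ℕ → ℕ} {w : List ℕ} (hw : IsGon k w)
    {g : Fin w.length → ℕ} (hg : Occ h n w g) {b : Fin w.length} (hb : h (g b) = 0) (hk : 3 ≤ k) :
    w.get b ≤ 1 ∧ k - 1 ≤ (b : ℕ) := by
  obtain ⟨c, hc⟩ := List.mem_iff_get.1 (hw.mem 1 le_rfl (by omega))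
  have h1 : w.get b ≤ 1 := by
    by_contra hlt
    have := (hg.iso c b).1 (by omega)
    omega
  refine ⟨h1, ?_⟩
  by_contra hlt
  have := hw.initial b (w.get b) (by omega) (by simp)
  omega

/-- In an occurrence of a `k`-gon using position `0`, at least `k - 1` values lie below the first
one; if there are only `k - 1` such values in all, then they are all used and the pattern starts
with `k`. -/
lemma IsGon.of_first {k n : ℕ} {h : ℕ → ℕ} (hh : Function.Injective h) {w : List ℕ}
    (hw : IsGon k w) {g : Fin w.length → ℕ} (hg : Occ h n w g) {b : Fin w.length} (hb : g b = 0)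
    (hk : 3 ≤ k) :
    (b : ℕ) = 0 ∧ k - 1 ≤ h 0 ∧ (h 0 = k - 1 → w.get b = k ∧ ∃ c, h (g c) = 0) := by
  have hb0 : (b : ℕ) = 0 := by have := le_of_strictMono hg.mono b; omega
  have hhead := hw.head
  have hwb : w[0]? = some (w.get b) := by simp [← hb0]
  rw [hwb] at hhead
  simp only [Option.some.injEq] at hhead
  have hex : ∀ v : ℕ, ∃ c : Fin w.length, 1 ≤ v → v ≤ 2 * k → w.get c = v := fun v => by
    by_cases hv : 1 ≤ v ∧ v ≤ 2 * k
    · obtain ⟨c, hc⟩ := List.mem_iff_get.1 (hw.mem v hv.1 hv.2)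
      exact ⟨c, fun _ _ => hc⟩
    · exact ⟨b, fun h1 h2 => absurd ⟨h1, h2⟩ hv⟩
  choose c hc using hex
  have hinj : ∀ m, m + 1 ≤ w.get b → Set.InjOn (fun v => h (g (c v))) (Finset.Icc 1 m : Finset ℕ) := by
    intro m hm u hu v hv huv
    simp only [Finset.coe_Icc, Set.mem_Icc] at hu hv
    have := hg.mono.injective (hh huv)
    have h1 := hc u (by omega) (by omega)
    have h2 := hc v (by omega) (by omega)
    rw [this] at h1
    omega
  have hmaps : ∀ m, m + 1 ≤ w.get b →
      (Finset.Icc 1 m).image (fun v => h (g (c v))) ⊆ Finset.range (h 0) := by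
    intro m hm u hu
    simp only [Finset.mem_image, Finset.mem_Icc] at hu
    obtain ⟨v, hv, rfl⟩ := hu
    have := (hg.iso (c v) b).1 (by rw [hc v (by omega) (by omega)]; omega)
    rw [hb] at this
    simpa using this
  have hcard : ∀ m, m + 1 ≤ w.get b → m ≤ h 0 := by
    intro m hm
    have := Finset.card_le_card (hmaps m hm)
    rwa [Finset.card_image_of_injOn (hinj m hm), Nat.card_Icc, Finset.card_range] at this
  refine ⟨hb0, hcard _ (by omega), fun h0 => ?_⟩
  have hk' : w.get b = k := by
    rcases hhead with h1 | h1
    · exact h1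
    · have := hcard k (by omega)
      omega
  refine ⟨hk', ?_⟩
  have heq := Finset.eq_of_subset_of_card_le (hmaps (k - 1) (by omega)) (by
    rw [Finset.card_image_of_injOn (hinj _ (by omega)), Nat.card_Icc, Finset.card_range]; omega)
  have hmem : 0 ∈ (Finset.Icc 1 (k - 1)).image (fun v => h (g (c v))) := by
    rw [heq]; simp; omega
  obtain ⟨v, -, hv⟩ := Finset.mem_image.1 hmem
  exact ⟨_, hv⟩

lemma avoidsLine_insertLine_iff {k n p q : ℕ} (hk : 3 ≤ k) (hp : p ≤ n) {h : ℕ → ℕ}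
    (h321 : ∀ x y z, x < y → y < z → z < n + 1 → insertLine p q h z < insertLine p q h y →
      insertLine p q h y < insertLine p q h x →
      ∃ x y z, x < y ∧ y < z ∧ z < n + 1 ∧ insertLine p q h z < insertLine p q h y ∧
      insertLine p q h y < insertLine p q h x ∧ x ≠ p ∧ y ≠ p ∧ z ≠ p)
    (hgon : ∀ w, IsGon k w → ∀ g, Occ (insertLine p q h) (n + 1) w g →
      ∃ g, Occ (insertLine p q h) (n + 1) w g ∧ ∀ a, g a ≠ p) :
    AvoidsLine k (n + 1) (insertLine p q h) ↔ AvoidsLine k n h := by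
  refine forall₂_congr fun w hw => not_congr (exists_occ_insertLine_iff hp fun g hg => ?_)
  rcases eq_or_isGon_of_mem_forbidden hk hw with rfl | hw
  · obtain ⟨x, y, z, h1, h2, h3, h4, h5, -⟩ :=
      (exists_occ_321_iff (h := insertLine p q h) (n := n + 1) (fun _ => True)).1
        ⟨g, hg, fun _ => trivial⟩
    exact (exists_occ_321_iff _).2 (h321 x y z h1 h2 h3 h4 h5)
  · exact hgon w hw g hg

/-- An entry `0` preceded by at most `k - 2` increasing entries is irrelevant. -/
lemma avoidsLine_insert_zero_early {k n p : ℕ} (hk : 3 ≤ k) (hp : p ≤ n) (hpk : p < k - 1)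
    {h : ℕ → ℕ} (hinc : ∀ i j, i < j → j < p → h i < h j) :
    AvoidsLine k (n + 1) (insertLine p 0 h) ↔ AvoidsLine k n h := by
  have hp0 : insertLine p 0 h p = 0 := by simp [insertLine]
  have hlt : ∀ i < p, insertLine p 0 h i = h i + 1 := by
    intro i hi; simp [insertLine, hi, bump]
  refine avoidsLine_insertLine_iff hk hp (fun x y z h1 h2 h3 h4 h5 => ?_) fun w hw g hg => ?_
  · refine ⟨x, y, z, h1, h2, h3, h4, h5, ?_, ?_, ?_⟩
    · rintro rfl; omega
    · rintro rfl; omega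
    · rintro rfl
      rw [hlt x (by omega), hlt y (by omega)] at h5
      have := hinc x y h1 h2
      omega
  · refine ⟨g, hg, fun b hb => ?_⟩
    have := (hw.le_of_zero hg (b := b) (by rw [hb, hp0]) hk).2
    have := le_of_strictMono hg.mono b
    omega

lemma exists_321_avoiding_zero {n : ℕ} {h : ℕ → ℕ} (h01 : h 0 < h 1) {x y z : ℕ}
    (h1 : x < y) (h2 : y < z) (h3 : z < n) (h4 : h z < h y) (h5 : h y < h x) :
    ∃ x y z, x < y ∧ y < z ∧ z < n ∧ h z < h y ∧ h y < h x ∧ x ≠ 0 ∧ y ≠ 0 ∧ z ≠ 0 := by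
  rcases Nat.eq_zero_or_pos x with rfl | hx
  · have : y ≠ 1 := by rintro rfl; omega
    exact ⟨1, y, z, by omega, h2, h3, h4, by omega, by omega, by omega, by omega⟩
  · exact ⟨x, y, z, h1, h2, h3, h4, h5, by omega, by omega, by omega⟩

/-- A small first entry followed by a larger one is irrelevant. -/
lemma avoidsLine_insert_first {k n q : ℕ} (hk : 3 ≤ k) {h : ℕ → ℕ} (hqn : q ≤ n) (hh : IsLine n h)
    (hq : q < k - 1) (h01 : q ≤ h 0) :
    AvoidsLine k (n + 1) (insertLine 0 q h) ↔ AvoidsLine k n h := by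
  have hH := isLine_insertLine (Nat.zero_le n) hqn hh
  have hp0 : insertLine 0 q h 0 = q := by simp [insertLine]
  have hp1 : insertLine 0 q h 1 = h 0 + 1 := by
    simp [insertLine, bump]; omega
  refine avoidsLine_insertLine_iff hk (Nat.zero_le n) (fun x y z h1 h2 h3 h4 h5 =>
    exists_321_avoiding_zero (by omega) h1 h2 h3 h4 h5) fun w hw g hg => ⟨g, hg, fun b hb => ?_⟩
  have := (hw.of_first hH.inj hg hb hk).2.1
  omega

/-- In `k, k+1, …, 1, …` with the entry `1` at place `k`, the first entry is irrelevant. -/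
lemma avoidsLine_insert_first_of_consecutive {k n : ℕ} (hk : 3 ≤ k) (hkn : k ≤ n) {h : ℕ → ℕ}
    (hh : IsLine n h) (h0 : h 0 = k - 1) (hz : h (k - 2) = 0) :
    AvoidsLine k (n + 1) (insertLine 0 (k - 1) h) ↔ AvoidsLine k n h := by
  have hH := isLine_insertLine (Nat.zero_le n) (show k - 1 ≤ n by omega) hh
  have hp0 : insertLine 0 (k - 1) h 0 = k - 1 := by simp [insertLine]
  have hp1 : insertLine 0 (k - 1) h 1 = k := by
    simp [insertLine, bump, h0]; omega
  have hpz : insertLine 0 (k - 1) h (k - 1) = 0 := by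
    rw [← hz]; grind [insertLine, bump]
  refine avoidsLine_insertLine_iff hk (Nat.zero_le n) (fun x y z h1 h2 h3 h4 h5 =>
    exists_321_avoiding_zero (by omega) h1 h2 h3 h4 h5) fun w hw g hg => ⟨g, hg, fun b hb => ?_⟩
  obtain ⟨hb0, -, hb'⟩ := hw.of_first hH.inj hg hb hk
  obtain ⟨hwb, c, hc⟩ := hb' hp0
  have hgc : g c = k - 1 := hH.inj (by rw [hc, hpz])
  have hck := (hw.le_of_zero hg hc hk).2
  have hcle := le_of_strictMono hg.mono c
  have hc' : (c : ℕ) = k - 1 := by omega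
  obtain ⟨h1len, h1v⟩ := List.getElem?_eq_some_iff.1 hw.second
  let e : Fin w.length := ⟨1, h1len⟩
  have hge : g e = 1 := by
    have := add_le_of_strictMono hg.mono (show e ≤ c from Fin.le_def.2 (by simp only [e]; omega))
    have := le_of_strictMono hg.mono e
    simp only [e] at *
    omega
  obtain ⟨d, hd⟩ := List.mem_iff_get.1 (hw.mem (k + 1) (by omega) (by omega))
  have hwe : w.get e = k + 2 := h1v
  have i1 := (hg.iso b d).1 (by omega)
  have i2 := (hg.iso d e).1 (by omega)
  rw [hb] at i1
  rw [hge] at i2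
  omega

/-- If `1, 2` occupy places `k, k+1` after increasing entries, the entry `1` is irrelevant. -/
lemma avoidsLine_insert_zero_of_consecutive {k n : ℕ} (hk : 3 ≤ k) (hkn : k ≤ n) {h : ℕ → ℕ}
    (hh : IsLine n h) (hz : h (k - 1) = 0) (hinc : ∀ i j, i < j → j < k - 1 → h i < h j) :
    AvoidsLine k (n + 1) (insertLine (k - 1) 0 h) ↔ AvoidsLine k n h := by
  have hH := isLine_insertLine (show k - 1 ≤ n by omega) (Nat.zero_le n) hh
  have hp0 : insertLine (k - 1) 0 h (k - 1) = 0 := by simp [insertLine]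
  have hp1 : insertLine (k - 1) 0 h k = 1 := by
    grind [insertLine, bump]
  have hlt : ∀ i < k - 1, insertLine (k - 1) 0 h i = h i + 1 := by
    intro i hi; simp [insertLine, hi, bump]
  refine avoidsLine_insertLine_iff hk (by omega) (fun x y z h1 h2 h3 h4 h5 => ?_) fun w hw g hg => ?_
  · refine ⟨x, y, z, h1, h2, h3, h4, h5, ?_, ?_, ?_⟩
    · rintro rfl; omega
    · rintro rfl; omega
    · rintro rfl
      rw [hlt x (by omega), hlt y (by omega)] at h5
      have := hinc x y h1 h2
      omega
  · by_cases hex : ∃ b, g b = k - 1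
    swap
    · exact ⟨g, hg, fun a ha => hex ⟨a, ha⟩⟩
    obtain ⟨b, hb⟩ := hex
    have hb0 : insertLine (k - 1) 0 h (g b) = 0 := by rw [hb, hp0]
    obtain ⟨hwb, hbk⟩ := hw.le_of_zero hg hb0 hk
    have hbk' : (b : ℕ) = k - 1 := by have := le_of_strictMono hg.mono b; omega
    have htop := hw.top (w.get b) (by simp [← hbk']) hwb
    have hne : ∀ c, g c ≠ k := by
      intro c hc
      have hbc : b < c := hg.mono.lt_iff_lt.1 (by omega)
      have hck : (c : ℕ) = k := by
        have := le_of_strictMono hg.mono c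
        have : (b : ℕ) < c := hbc
        omega
      have hwc : w.get c = 2 * k := by
        have : w[k]? = some (w.get c) := by simp [← hck]
        rw [this] at htop
        simpa using htop
      obtain ⟨d, hd⟩ := List.mem_iff_get.1 (hw.mem 2 (by omega) (by omega))
      have i1 := (hg.iso d c).1 (by omega)
      rw [hc, hp1] at i1
      have hdb : g d = g b := hH.inj (by rw [hb0]; omega)
      rw [hg.mono.injective hdb] at hd
      omega
    have hval : ∀ c, c ≠ b → 2 ≤ insertLine (k - 1) 0 h (g c) := by
      intro c hc
      have h0 : insertLine (k - 1) 0 h (g c) ≠ 0 := fun h0 =>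
        hc (hg.mono.injective (hH.inj (h0.trans hb0.symm)))
      have h1 : insertLine (k - 1) 0 h (g c) ≠ 1 := fun h1 => hne c (hH.inj (h1.trans hp1.symm))
      omega
    refine ⟨Function.update g b k, ⟨fun a c hac => ?_, fun a => ?_, fun a c => ?_⟩, fun a => ?_⟩
    · have := hg.mono hac
      have := hne a
      have := hne c
      by_cases ha : a = b <;> by_cases hc : c = b <;>
        simp only [Function.update_apply, ha, hc, if_true, if_false] at * <;> omega
    · have := hg.lt a
      by_cases ha : a = b <;> simp only [Function.update_apply, ha, if_true, if_false] <;> omega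
    · rw [hg.iso, Function.update_apply, Function.update_apply]
      split_ifs with ha hc hc
      · simp [ha, hc]
      · have := hval c hc
        rw [ha, hb0, hp1]
        omega
      · have := hval a ha
        rw [hc, hb0, hp1]
        omega
      · rfl
    · by_cases ha : a = b
      · simp only [Function.update_apply, ha, if_true]; omega
      · simp only [Function.update_apply, ha, if_false]
        intro h
        exact ha (hg.mono.injective (h.trans hb.symm))


/-- Among entries below `h i`, to the right of position `i`, values increase with positions. -/
lemma AvoidsLine.pos_lt {k n : ℕ} {h : ℕ → ℕ} (hh : AvoidsLine k n h) {i x y : ℕ}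
    (hiy : i < y) (hx : x < n) (hxy : h x < h y) (hy : h y < h i) : x < y := by
  by_contra hlt
  have hne : x ≠ y := by rintro rfl; omega
  exact hh.not_321 hiy (show y < x by omega) hx hxy hy

/-- Entries `i₁ < ⋯ < i_{k-1}`, `1`, `x` with `i₁ > k` and `x > i_{k-1}` force a forbidden pattern. -/
lemma AvoidsLine.first_le {K n : ℕ} {h : ℕ → ℕ} (hh : AvoidsLine (K + 3) n h) (hl : IsLine n h)
    (hn : K + 3 < n) (hinc : ∀ i j, i < j → j < K + 2 → h i < h j) (h0 : K + 2 ≤ h 0)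
    (hz : h (K + 2) = 0) (hx : h (K + 1) < h (K + 3)) : h 0 = K + 2 := by
  by_contra hne
  have hge : ∀ i < K + 2, h 0 ≤ h i := fun i hi => by
    rcases Nat.eq_zero_or_pos i with rfl | hi0
    · rfl
    · exact (hinc 0 i hi0 hi).le
  have hex : ∀ v, ∃ r, v < K + 2 → h r = v + 1 ∧ K + 3 < r ∧ r < n := fun v => by
    by_cases hv : v < K + 2
    swap
    · exact ⟨0, fun h => absurd h hv⟩
    have := hl.lt 0 (by omega)
    obtain ⟨r, hr, hrv⟩ := hl.surj (v + 1) (by omega)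
    refine ⟨r, fun _ => ⟨hrv, ?_, hr⟩⟩
    by_contra hlt
    rcases (show r < K + 2 ∨ r = K + 2 ∨ r = K + 3 by omega) with h1 | rfl | rfl
    · have := hge r h1; omega
    · omega
    · have := hge (K + 1) (by omega); omega
  choose r hr using hex
  have hrmono : ∀ u v, u < v → v < K + 2 → r u < r v := fun u v huv hv => by
    have hu := hr u (by omega)
    have hv := hr v hv
    exact hh.pos_lt (i := 0) (by omega) hu.2.2 (by omega) (by omega)
  refine hh (gonPattern (K + 3) (K + 4) true) (by simp [forbidden]) ?_
  rw [gonPattern_succ]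
  refine ⟨fun a => if (a : ℕ) ≤ K + 3 then a else r (a - (K + 4)), fun a b hab => ?_, fun a => ?_,
    fun a b => ?_⟩
  · have hab' : (a : ℕ) < b := hab
    have hb := b.isLt
    simp at hb
    have := hr (b - (K + 4))
    have := hrmono (a - (K + 4)) (b - (K + 4))
    split_ifs <;> omega
  · have ha := a.isLt
    simp at ha
    have := hr (a - (K + 4))
    split_ifs <;> omega
  · have hform : ∀ c (hc : c < (List.range' (K + 4) (K + 2) ++ [1, 2 * K + 6] ++
        List.range' 2 (K + 2)).length),
        (List.range' (K + 4) (K + 2) ++ [1, 2 * K + 6] ++ List.range' 2 (K + 2))[c] =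
          if c < K + 2 then K + 4 + c else if c = K + 2 then 1 else if c = K + 3 then 2 * K + 6
          else c - (K + 2) := by
      intro c hc
      simp [List.getElem_append, List.getElem_cons]
      grind
    obtain ⟨a, ha⟩ := a
    obtain ⟨b, hb⟩ := b
    simp only [List.get_eq_getElem, hform]
    simp at ha hb
    have hE : ∀ c, c < 2 * K + 6 → (c < K + 2 ∧ h (if c ≤ K + 3 then c else r (c - (K + 4))) = h c) ∨
        (c = K + 2 ∧ h (if c ≤ K + 3 then c else r (c - (K + 4))) = 0) ∨
        (c = K + 3 ∧ h (if c ≤ K + 3 then c else r (c - (K + 4))) = h (K + 3)) ∨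
        (K + 4 ≤ c ∧ h (if c ≤ K + 3 then c else r (c - (K + 4))) = c - (K + 3)) := by
      intro c hc
      rcases (show c < K + 2 ∨ c = K + 2 ∨ c = K + 3 ∨ K + 4 ≤ c by omega) with h1 | h1 | h1 | h1
      · rw [if_pos (by omega)]; omega
      · rw [if_pos (by omega), h1]; omega
      · rw [if_pos (by omega), h1]; omega
      · rw [if_neg (by omega), (hr (c - (K + 4)) (by omega)).1]; omega
    have hle : ∀ c, c < K + 2 → h c ≤ h (K + 1) := fun c hc => by
      rcases (show c = K + 1 ∨ c < K + 1 by omega) with rfl | h1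
      · rfl
      · exact (hinc c (K + 1) h1 (by omega)).le
    have la := hle a
    have lb := hle b
    have ga := hge a
    have gb := hge b
    have iab := hinc a b
    have iba := hinc b a
    have hlast := hge (K + 1) (by omega)
    have heq : a = b → h a = h b := congrArg h
    have Ea := hE a (by omega)
    have Eb := hE b (by omega)
    generalize h (if a ≤ K + 3 then a else r (a - (K + 4))) = u at *
    generalize h (if b ≤ K + 3 then b else r (b - (K + 4))) = v at *
    clear hE hinc hge hr hrmono hform hle hh hl
    rcases Ea with ⟨ha1, rfl⟩ | ⟨ha1, rfl⟩ | ⟨ha1, rfl⟩ | ⟨ha1, rfl⟩ <;>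
      rcases Eb with ⟨hb1, rfl⟩ | ⟨hb1, rfl⟩ | ⟨hb1, rfl⟩ | ⟨hb1, rfl⟩ <;>
      split_ifs <;> omega

set_option maxHeartbeats 1000000 in
/-- Entries `k < i₂ < ⋯ < i_{k-1}`, `1`, `x` with `x > i_{k-1}` force `i₂ = k + 1`. -/
lemma AvoidsLine.second_eq {K n : ℕ} {h : ℕ → ℕ} (hh : AvoidsLine (K + 3) n h) (hl : IsLine n h)
    (hn : K + 3 < n) (hinc : ∀ i j, i < j → j < K + 2 → h i < h j) (h0 : h 0 = K + 2)
    (hz : h (K + 2) = 0) (hx : h (K + 1) < h (K + 3)) : h 1 = K + 3 := by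
  by_contra hne
  have h01 := hinc 0 1 (by omega) (by omega)
  have hge : ∀ i < K + 2, i = 0 ∨ h 1 ≤ h i := fun i hi => by
    rcases (show i = 0 ∨ i = 1 ∨ 1 < i by omega) with rfl | rfl | hi0
    · exact Or.inl rfl
    · exact Or.inr le_rfl
    · exact Or.inr (hinc 1 i hi0 hi).le
  have hex : ∀ v, ∃ r, v < K + 2 → h r = (if v < K + 1 then v + 1 else K + 3) ∧ K + 3 < r ∧ r < n :=
    fun v => by
    by_cases hv : v < K + 2
    swap
    · exact ⟨0, fun h => absurd h hv⟩
    have := hl.lt 1 (by omega)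
    obtain ⟨r, hr, hrv⟩ := hl.surj (if v < K + 1 then v + 1 else K + 3) (by split_ifs <;> omega)
    refine ⟨r, fun _ => ⟨hrv, ?_, hr⟩⟩
    by_contra hlt
    rcases (show r < K + 2 ∨ r = K + 2 ∨ r = K + 3 by omega) with h1 | rfl | rfl
    · rcases hge r h1 with rfl | h1 <;> split_ifs at hrv <;> omega
    · split_ifs at hrv <;> omega
    · have := hge (K + 1) (by omega)
      split_ifs at hrv <;> omega
  choose r hr using hex
  have hrmono : ∀ u v, u < v → v < K + 2 → r u < r v := fun u v huv hv => by
    have hu := hr u (by omega)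
    have hv := hr v hv
    rw [if_pos (by omega)] at hu
    exact hh.pos_lt (i := 1) (by omega) hu.2.2 (by rw [hu.1, hv.1]; split_ifs <;> omega)
      (by rw [hv.1]; split_ifs <;> omega)
  refine hh (gonPattern (K + 3) (K + 3) true) (by simp [forbidden]) ?_
  rw [gonPattern_self]
  refine ⟨fun a => if (a : ℕ) ≤ K + 3 then a else r (a - (K + 4)), fun a b hab => ?_, fun a => ?_,
    fun a b => ?_⟩
  · have hab' : (a : ℕ) < b := hab
    have hb := b.isLt
    simp at hb
    have := hr (b - (K + 4))
    have := hrmono (a - (K + 4)) (b - (K + 4))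
    split_ifs <;> omega
  · have ha := a.isLt
    simp at ha
    have := hr (a - (K + 4))
    split_ifs <;> omega
  · have hform : ∀ c (hc : c < ((K + 3) :: List.range' (K + 5) (K + 1) ++ [1, 2 * K + 6] ++
        List.range' 2 (K + 1) ++ [K + 4]).length),
        ((K + 3) :: List.range' (K + 5) (K + 1) ++ [1, 2 * K + 6] ++
        List.range' 2 (K + 1) ++ [K + 4])[c] =
          if c = 0 then K + 3 else if c < K + 2 then K + 4 + c else if c = K + 2 then 1
          else if c = K + 3 then 2 * K + 6 else if c < 2 * K + 5 then c - (K + 2) else K + 4 := by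
      intro c hc
      simp [List.getElem_append, List.getElem_cons]
      grind
    obtain ⟨a, ha⟩ := a
    obtain ⟨b, hb⟩ := b
    simp only [List.get_eq_getElem, hform]
    simp at ha hb
    have hE : ∀ c, c < 2 * K + 6 → (c < K + 2 ∧ h (if c ≤ K + 3 then c else r (c - (K + 4))) = h c) ∨
        (c = K + 2 ∧ h (if c ≤ K + 3 then c else r (c - (K + 4))) = 0) ∨
        (c = K + 3 ∧ h (if c ≤ K + 3 then c else r (c - (K + 4))) = h (K + 3)) ∨
        (K + 4 ≤ c ∧ h (if c ≤ K + 3 then c else r (c - (K + 4))) = if c < 2 * K + 5 then c - (K + 3) else K + 3) := by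
      intro c hc
      rcases (show c < K + 2 ∨ c = K + 2 ∨ c = K + 3 ∨ K + 4 ≤ c by omega) with h1 | h1 | h1 | h1
      · rw [if_pos (by omega)]; omega
      · rw [if_pos (by omega), h1]; omega
      · rw [if_pos (by omega), h1]; omega
      · rw [if_neg (by omega), (hr (c - (K + 4)) (by omega)).1]
        split_ifs <;> omega
    have hle : ∀ c, c < K + 2 → h c ≤ h (K + 1) := fun c hc => by
      rcases (show c = K + 1 ∨ c < K + 1 by omega) with rfl | h1
      · rfl
      · exact (hinc c (K + 1) h1 (by omega)).le
    have la := hle a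
    have lb := hle b
    have ga := hge a
    have gb := hge b
    have iab := hinc a b
    have iba := hinc b a
    have hlast := hge (K + 1) (by omega)
    have heq : a = b → h a = h b := congrArg h
    have za : a = 0 → h a = h 0 := fun h' => by rw [h']
    have zb : b = 0 → h b = h 0 := fun h' => by rw [h']
    have Ea := hE a (by omega)
    have Eb := hE b (by omega)
    generalize h (if a ≤ K + 3 then a else r (a - (K + 4))) = u at *
    generalize h (if b ≤ K + 3 then b else r (b - (K + 4))) = v at *
    clear hE hinc hge hr hrmono hform hle hh hl
    rcases Ea with ⟨ha1, rfl⟩ | ⟨ha1, rfl⟩ | ⟨ha1, rfl⟩ | ⟨ha1, rfl⟩ <;>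
      rcases Eb with ⟨hb1, rfl⟩ | ⟨hb1, rfl⟩ | ⟨hb1, rfl⟩ | ⟨hb1, rfl⟩ <;>
      split_ifs <;> omega


lemma startsWith_iff {n : ℕ} (π : Perm (Fin n)) {l : List ℕ} (hl : l.length ≤ n) :
    StartsWith π l ↔ ∀ j (hj : j < l.length), lineFun π j + 1 = l[j] := by
  constructor
  · intro h j hj
    have := h ⟨j, hj⟩ (by simp; omega)
    simpa [lineFun, show j < n by omega] using this
  · intro h j hj
    have := h j j.isLt
    simpa [lineFun, hj] using this

/-- The first `m` entries of `h` increase, and are at least `d` when counted from `1`. -/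
def InitialIncr (d m : ℕ) (h : ℕ → ℕ) : Prop :=
  (∀ i j, i < j → j < m → h i < h j) ∧ ∀ i < m, d ≤ h i + 1

lemma sum_startsWith (n m d : ℕ) (hm : m ≤ n) (P : (ℕ → ℕ) → Prop) :
    ∑ s ∈ (Finset.Icc d n).powersetCard m, Nat.card {π : Perm (Fin n) // P (lineFun π) ∧
      StartsWith π (s.sort (· ≤ ·))} = countLine n (fun h => P h ∧ InitialIncr d m h) := by
  classical
  simp only [countLine, Nat.card_eq_fintype_card, Fintype.card_subtype]
  rw [Finset.card_eq_sum_card_fiberwise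
    (f := fun π => (Finset.range m).image (fun i => lineFun π i + 1))
    (t := (Finset.Icc d n).powersetCard m)]
  · refine Finset.sum_congr rfl fun s hs => ?_
    obtain ⟨hsub, hcard⟩ := Finset.mem_powersetCard.1 hs
    have hlen : (s.sort (· ≤ ·)).length = m := by simp [hcard]
    congr 1
    ext π
    simp only [Finset.mem_filter, Finset.mem_univ, true_and]
    rw [startsWith_iff π (by omega), and_assoc]
    refine and_congr_right fun _ => ⟨fun h => ⟨⟨fun i j hij hj => ?_, fun i hi => ?_⟩, ?_⟩, ?_⟩
    · have hi := h i (by omega)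
      have hj' := h j (by omega)
      have := (List.pairwise_iff_getElem.1 (Finset.sortedLT_sort s).pairwise) i j
        (by omega) (by omega) hij
      omega
    · have hi' := h i (by omega)
      have : (s.sort (· ≤ ·))[i]'(by omega) ∈ s := (Finset.mem_sort (· ≤ ·)).1 (List.getElem_mem _)
      rw [hi']
      exact (Finset.mem_Icc.1 (hsub this)).1
    · ext v
      simp only [Finset.mem_image, Finset.mem_range]
      rw [← Finset.mem_sort (s := s) (· ≤ ·), List.mem_iff_getElem]
      constructor
      · rintro ⟨i, hi, rfl⟩
        exact ⟨i, by omega, (h i (by omega)).symm⟩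
      · rintro ⟨i, hi, rfl⟩
        exact ⟨i, by omega, h i hi⟩
    · rintro ⟨⟨hinc, -⟩, himg⟩ j hj
      have hp : ((List.range m).map fun i => lineFun π i + 1).Pairwise (· < ·) := by
        rw [List.pairwise_map]
        refine List.pairwise_lt_range.imp_of_mem fun {a b} _ hb hab => ?_
        have := hinc a b hab (List.mem_range.1 hb)
        omega
      have heq : s.sort (· ≤ ·) = (List.range m).map fun i => lineFun π i + 1 := by
        refine List.Perm.eq_of_pairwise (le := (· < ·)) (fun a b _ _ h h' => by omega)
          (Finset.sortedLT_sort s).pairwise hp ?_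
        rw [List.perm_ext_iff_of_nodup (Finset.sort_nodup _ _) hp.nodup]
        intro v
        rw [Finset.mem_sort, ← himg]
        simp
      simp [heq]
  · intro π hπ
    obtain ⟨-, hinc, hd⟩ : P (lineFun π) ∧ InitialIncr d m (lineFun π) := by simpa using hπ
    rw [Finset.mem_coe, Finset.mem_powersetCard]
    constructor
    · intro v hv
      simp only [Finset.mem_image, Finset.mem_range] at hv
      obtain ⟨i, hi, rfl⟩ := hv
      have := (isLine_lineFun π).lt i (by omega)
      have := hd i hi
      exact Finset.mem_Icc.2 ⟨by omega, by omega⟩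
    · rw [Finset.card_image_of_injective, Finset.card_range]
      intro i j hij
      exact (isLine_lineFun π).inj (by simpa using hij)

lemma Aseq_eq_countLine (k d n m : ℕ) (hm : m ≤ n) :
    Aseq k d n m = countLine n (fun h => AvoidsLine k n h ∧ InitialIncr d m h) := by
  rw [← sum_startsWith n m d hm]
  simp only [Aseq, fstart, avoids321Gon_iff]

lemma Cseq_eq_countLine (k d n m : ℕ) (hm : m < n) :
    Cseq k d n m = countLine n (fun h => (AvoidsLine k n h ∧ h m = 0) ∧ InitialIncr d m h) := by
  rw [← sum_startsWith n m d hm.le]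
  refine Finset.sum_congr rfl fun s hs => ?_
  have hlen : (s.sort (· ≤ ·)).length = m := by
    simp [(Finset.mem_powersetCard.1 hs).2]
  refine Nat.card_congr (Equiv.subtypeEquivRight fun π => ?_)
  rw [avoids321Gon_iff, startsWith_iff π (by simp [hlen]; omega), startsWith_iff π (by omega),
    and_assoc]
  refine and_congr_right fun _ => ⟨fun h => ⟨?_, fun j hj => ?_⟩, fun ⟨h0, h⟩ j hj => ?_⟩
  · simpa [hlen] using h m (by simp [hlen])
  · rw [h j (by simp at hj ⊢; omega), List.getElem_append_left hj]
  · rcases (show j < m ∨ j = m by simp [hlen] at hj; omega) with h1 | rfl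
    · rw [h j (by omega), List.getElem_append_left]
    · simp [List.getElem_append_right, hlen, h0]

/-- The contribution of the permutations in which `2` directly follows `1`. -/
lemma countLine_one_two (K n : ℕ) (hn : K + 3 ≤ n) :
    countLine (n + 1) (fun h => ((AvoidsLine (K + 3) (n + 1) h ∧ h (K + 2) = 0) ∧
      InitialIncr (K + 3) (K + 2) h) ∧ h (K + 3) = 1) =
    countLine n (fun h => (AvoidsLine (K + 3) n h ∧ h (K + 2) = 0) ∧
      InitialIncr (K + 2) (K + 2) h) := by
  rw [countLine_insert (p := K + 2) (q := 0) (by omega) (by omega) (fun f hf => hf.1.1.2)]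
  refine countLine_congr fun h hh => ?_
  have hlt : ∀ i < K + 2, insertLine (K + 2) 0 h i = h i + 1 := by
    intro i hi; simp [insertLine, hi, bump]
  have hp : insertLine (K + 2) 0 h (K + 2) = 0 := by simp [insertLine]
  have hp' : insertLine (K + 2) 0 h (K + 3) = h (K + 2) + 1 := by simp [insertLine, bump]
  have hI : InitialIncr (K + 3) (K + 2) (insertLine (K + 2) 0 h) ↔
      InitialIncr (K + 2) (K + 2) h := by
    unfold InitialIncr
    constructor
    · rintro ⟨h1, h2⟩
      refine ⟨fun i j hij hj => ?_, fun i hi => ?_⟩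
      · have := h1 i j hij hj
        rw [hlt i (by omega), hlt j hj] at this; omega
      · have := h2 i hi
        rw [hlt i hi] at this; omega
    · rintro ⟨h1, h2⟩
      refine ⟨fun i j hij hj => ?_, fun i hi => ?_⟩
      · have := h1 i j hij hj
        rw [hlt i (by omega), hlt j hj]; omega
      · have := h2 i hi
        rw [hlt i hi]; omega
  rw [hI, hp, hp']
  have key : h (K + 2) = 0 → InitialIncr (K + 2) (K + 2) h →
      (AvoidsLine (K + 3) (n + 1) (insertLine (K + 2) 0 h) ↔ AvoidsLine (K + 3) n h) :=
    fun hz hi => avoidsLine_insert_zero_of_consecutive (k := K + 3) (by omega) hn hh hz hi.1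
  constructor
  · rintro ⟨⟨⟨h1, -⟩, h2⟩, h3⟩
    have h3 : h (K + 2) = 0 := by omega
    exact ⟨⟨(key h3 h2).1 h1, h3⟩, h2⟩
  · rintro ⟨⟨h1, h3⟩, h2⟩
    exact ⟨⟨⟨(key h3 h2).2 h1, rfl⟩, h2⟩, by omega⟩

/-- The contribution of the permutations starting with `k - 1` that have `1` at place `k`. -/
lemma countLine_first_small (K n : ℕ) (hn : K + 1 ≤ n) :
    countLine (n + 2) (fun h => ((AvoidsLine (K + 3) (n + 2) h ∧ h (K + 2) = 0) ∧
      InitialIncr (K + 2) (K + 2) h) ∧ h 0 = K + 1) =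
    countLine n (fun h => AvoidsLine (K + 3) n h ∧ InitialIncr (K + 1) (K + 1) h) := by
  rw [countLine_insert (p := 0) (q := K + 1) (by omega) (by omega) (fun f hf => hf.2),
    countLine_insert (p := K + 1) (q := 0) (by omega) (by omega) (fun f hf => by
      have := hf.1.1.2
      grind [insertLine, bump])]
  refine countLine_congr fun h hh => ?_
  set e := insertLine (K + 1) 0 h with he
  have hel : IsLine (n + 1) e := isLine_insertLine (by omega) (by omega) hh
  have e1 : ∀ i < K + 1, e i = h i + 1 := by intro i hi; simp [he, insertLine, hi, bump]
  have e2 : e (K + 1) = 0 := by simp [he, insertLine]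
  set f := insertLine 0 (K + 1) e with hf
  have f0 : f 0 = K + 1 := by simp [hf, insertLine]
  have f1 : ∀ i, f (i + 1) = bump (K + 1) (e i) := by intro i; simp [hf, insertLine]
  have f2 : f (K + 2) = 0 := by rw [f1, e2]; simp [bump]
  have hI : InitialIncr (K + 2) (K + 2) f ↔ InitialIncr (K + 1) (K + 1) h := by
    constructor
    · rintro ⟨h1, h2⟩
      have key : ∀ i < K + 1, K + 1 ≤ e i ∧ f (i + 1) = h i + 2 := by
        intro i hi
        have a1 := h1 0 (i + 1) (by omega) (by omega)
        have a2 := f1 i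
        have a3 := e1 i hi
        unfold bump at a2
        split_ifs at a2 <;> omega
      refine ⟨fun i j hij hj => ?_, fun i hi => ?_⟩
      · have := h1 (i + 1) (j + 1) (by omega) (by omega)
        have := key i (by omega)
        have := key j (by omega)
        omega
      · have := key i hi
        have := e1 i hi
        omega
    · rintro ⟨h1, h2⟩
      have key : ∀ i < K + 1, f (i + 1) = h i + 2 := by
        intro i hi
        have a1 := h2 i hi
        have a3 := e1 i hi
        rw [f1, bump, if_neg (by omega)]; omega
      refine ⟨fun i j hij hj => ?_, fun i hi => ?_⟩
      · obtain ⟨j, rfl⟩ : ∃ j', j = j' + 1 := ⟨j - 1, by omega⟩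
        have b1 := key j (by omega)
        have b2 := h2 j (by omega)
        rcases i with _ | i
        · omega
        · have := key i (by omega)
          have := h1 i j (by omega) (by omega)
          omega
      · rcases i with _ | i
        · omega
        · have := key i (by omega)
          have := h2 i (by omega)
          omega
  rw [hI]
  have key : InitialIncr (K + 1) (K + 1) h →
      (AvoidsLine (K + 3) (n + 2) f ↔ AvoidsLine (K + 3) n h) := fun hi => by
    have := hi.2 0 (by omega)
    have := e1 0 (by omega)
    rw [hf, avoidsLine_insert_first (by omega) (by omega) hel (by omega) (by omega), he,
      avoidsLine_insert_zero_early (by omega) (by omega) (by omega) hi.1]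
  constructor
  · rintro ⟨⟨⟨h1, -⟩, h2⟩, -⟩
    exact ⟨(key h2).1 h1, h2⟩
  · rintro ⟨h1, h2⟩
    exact ⟨⟨⟨(key h2).2 h1, f2⟩, h2⟩, f0⟩

/-- The contribution of the permutations in which `2` does not directly follow `1`. -/
lemma countLine_not_one_two (K n : ℕ) (hn : K + 1 ≤ n) :
    countLine (n + 3) (fun h => ((AvoidsLine (K + 3) (n + 3) h ∧ h (K + 2) = 0) ∧
      InitialIncr (K + 3) (K + 2) h) ∧ ¬ h (K + 3) = 1) =
    countLine n (fun h => AvoidsLine (K + 3) n h ∧ InitialIncr (K + 2) (K + 1) h) := by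
  trans countLine (n + 3) (fun h => AvoidsLine (K + 3) (n + 3) h ∧ h 0 = K + 2 ∧ h 1 = K + 3 ∧
      h (K + 2) = 0 ∧ (∀ i j, i < j → j < K + 2 → h i < h j) ∧ h (K + 1) < h (K + 3))
  · refine countLine_congr fun h hh => ⟨?_, ?_⟩
    · rintro ⟨⟨⟨hav, hz⟩, hinc, hge⟩, hne⟩
      have h0 : K + 2 ≤ h 0 := by have := hge 0 (by omega); omega
      have hx : h (K + 1) < h (K + 3) := by
        obtain ⟨r, hr, hr1⟩ := hh.surj 1 (by omega)
        have hrK : K + 3 < r := by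
          by_contra hlt
          rcases (show r < K + 2 ∨ r = K + 2 ∨ r = K + 3 by omega) with h1 | rfl | rfl
          · have := hge r h1; omega
          · omega
          · omega
        have hne0 : h (K + 3) ≠ 0 := fun h' => by have := hh.inj (h'.trans hz.symm); omega
        have hne1 : h (K + 3) ≠ h (K + 1) := fun h' => by have := hh.inj h'; omega
        have := hav.not_321 (show K + 1 < K + 3 by omega) hrK hr (by omega)
        omega
      have h0' := hav.first_le hh (by omega) hinc h0 hz hx
      exact ⟨hav, h0', hav.second_eq hh (by omega) hinc h0' hz hx, hz, hinc, hx⟩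
    · rintro ⟨hav, h0, h1, hz, hinc, hx⟩
      have hge : ∀ i < K + 2, K + 2 ≤ h i := fun i hi => by
        rcases Nat.eq_zero_or_pos i with rfl | hi0
        · omega
        · have := hinc 0 i hi0 hi; omega
      have := hge (K + 1) (by omega)
      exact ⟨⟨⟨hav, hz⟩, hinc, fun i hi => by have := hge i hi; omega⟩, by omega⟩
  rw [countLine_insert (p := 0) (q := K + 2) (by omega) (by omega) (fun f hf => hf.2.1),
    countLine_insert (p := K + 1) (q := 0) (by omega) (by omega) (fun f hf => by
      have := hf.2.2.2.1
      grind [insertLine, bump]),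
    countLine_insert (p := 0) (q := K + 1) (by omega) (by omega) (fun f hf => by
      have := hf.2.2.1
      grind [insertLine, bump])]
  refine countLine_congr fun h hh => ?_
  set d := insertLine 0 (K + 1) h with hd
  have hdl : IsLine (n + 1) d := isLine_insertLine (by omega) (by omega) hh
  have d0 : d 0 = K + 1 := by simp [hd, insertLine]
  have d1 : ∀ i, d (i + 1) = bump (K + 1) (h i) := by intro i; simp [hd, insertLine]
  set e := insertLine (K + 1) 0 d with he
  have hel : IsLine (n + 2) e := isLine_insertLine (by omega) (by omega) hdl
  have e1 : ∀ i < K + 1, e i = d i + 1 := by intro i hi; simp [he, insertLine, hi, bump]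
  have e2 : e (K + 1) = 0 := by simp [he, insertLine]
  have e3 : e (K + 2) = d (K + 1) + 1 := by simp [he, insertLine, bump]
  set f := insertLine 0 (K + 2) e with hf
  have f0 : f 0 = K + 2 := by simp [hf, insertLine]
  have f1 : ∀ i, f (i + 1) = bump (K + 2) (e i) := by intro i; simp [hf, insertLine]
  have f2 : f (K + 2) = 0 := by rw [f1, e2]; simp [bump]
  have f3 : f 1 = K + 3 := by
    rw [f1, e1 0 (by omega), d0]; simp [bump]
  have fv : ∀ i < K, f (i + 2) = bump (K + 2) (bump (K + 1) (h i) + 1) := fun i hi => by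
    rw [f1 (i + 1), e1 (i + 1) (by omega), d1]
  have fl : f (K + 3) = bump (K + 2) (bump (K + 1) (h K) + 1) := by
    rw [f1 (K + 2), e3, d1]
  have bb : ∀ v, K + 1 ≤ v → bump (K + 2) (bump (K + 1) v + 1) = v + 3 := by
    intro v hv; grind [bump]
  have bb' : ∀ v, K + 3 < bump (K + 2) (bump (K + 1) v + 1) → K + 1 ≤ v := by
    intro v hv; grind [bump]
  have hI : ((∀ i j, i < j → j < K + 2 → f i < f j) ∧ f (K + 1) < f (K + 3)) ↔
      InitialIncr (K + 2) (K + 1) h := by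
    constructor
    · rintro ⟨h1, hx⟩
      have hx1 : K + 3 < f (K + 3) := by
        rcases Nat.eq_zero_or_pos K with rfl | hK
        · simpa [f3] using hx
        · have := h1 1 (K + 1) (by omega) (by omega); omega
      have key : ∀ i < K, K + 1 ≤ h i ∧ f (i + 2) = h i + 3 := by
        intro i hi
        have a1 := h1 1 (i + 2) (by omega) (by omega)
        rw [f3, fv i hi] at a1
        have := bb' _ a1
        exact ⟨this, (fv i hi).trans (bb _ this)⟩
      have keyl : K + 1 ≤ h K ∧ f (K + 3) = h K + 3 := by
        rw [fl] at hx1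
        have := bb' _ hx1
        exact ⟨this, fl.trans (bb _ this)⟩
      have hlt : ∀ i < K, f (i + 2) < f (K + 3) := fun i hi => by
        rcases (show i + 2 = K + 1 ∨ i + 2 < K + 1 by omega) with h' | h'
        · rw [h']; exact hx
        · exact (h1 _ _ h' (by omega)).trans hx
      refine ⟨fun i j hij hj => ?_, fun i hi => ?_⟩
      · rcases (show j = K ∨ j < K by omega) with rfl | hj
        · have := key i hij
          have := hlt i hij
          omega
        · have := key i (by omega)
          have := key j hj
          have := h1 (i + 2) (j + 2) (by omega) (by omega)
          omega
      · rcases (show i = K ∨ i < K by omega) with rfl | hi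
        · omega
        · have := key i hi; omega
    · rintro ⟨h1, h2⟩
      have key : ∀ i < K, f (i + 2) = h i + 3 := fun i hi => by
        have := h2 i (by omega)
        rw [fv i hi, bb _ (by omega)]
      have keyl : f (K + 3) = h K + 3 := by
        have := h2 K (by omega)
        rw [fl, bb _ (by omega)]
      constructor
      · intro i j hij hj
        rcases (show j = 1 ∨ 2 ≤ j by omega) with rfl | hj2
        · obtain rfl : i = 0 := by omega
          omega
        · obtain ⟨j, rfl⟩ : ∃ j', j = j' + 2 := ⟨j - 2, by omega⟩
          have := key j (by omega)
          have := h2 j (by omega)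
          rcases (show i = 0 ∨ i = 1 ∨ 2 ≤ i by omega) with rfl | rfl | hi2
          · omega
          · omega
          · obtain ⟨i, rfl⟩ : ∃ i', i = i' + 2 := ⟨i - 2, by omega⟩
            have := key i (by omega)
            have := h1 i j (by omega) (by omega)
            omega
      · have b := h2 K (by omega)
        rcases K with _ | K
        · simp only [Nat.zero_add] at *; omega
        · have : f (K + 1 + 1) = h K + 3 := key K (by omega)
          have := h1 K (K + 1) (by omega) (by omega)
          rw [keyl]
          omega
  have key : InitialIncr (K + 2) (K + 1) h →
      (AvoidsLine (K + 3) (n + 3) f ↔ AvoidsLine (K + 3) n h) := fun hi => by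
    have h0 := hi.2 0 (by omega)
    have he0 := e1 0 (by omega)
    rw [hf, show K + 2 = K + 3 - 1 by omega, avoidsLine_insert_first_of_consecutive (k := K + 3) (by omega) (by omega) hel
      (by omega) (by simpa using e2), he,
      avoidsLine_insert_zero_early (by omega) (by omega) (by omega), hd,
      avoidsLine_insert_first (by omega) (by omega) hh (by omega) (by omega)]
    intro i j hij hj
    obtain ⟨j, rfl⟩ : ∃ j', j = j' + 1 := ⟨j - 1, by omega⟩
    have hj1 := hi.2 j (by omega)
    have dj : d (j + 1) = h j + 1 := by rw [d1, bump, if_neg (by omega)]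
    rcases i with _ | i
    · omega
    · have hi1 := hi.2 i (by omega)
      have di : d (i + 1) = h i + 1 := by rw [d1, bump, if_neg (by omega)]
      have := hi.1 i j (by omega) (by omega)
      omega
  constructor
  · rintro ⟨h1, -, -, -, h2⟩
    have h2 := hI.1 h2
    exact ⟨(key h2).1 h1, h2⟩
  · rintro ⟨h1, h2⟩
    exact ⟨(key h2).2 h1, f0, f3, f2, hI.2 h2⟩

lemma powersetCard_Icc_eq_empty {d n m : ℕ} (h : n + 1 - d < m) :
    (Finset.Icc d n).powersetCard m = ∅ :=
  Finset.powersetCard_eq_empty.2 (by simpa using h)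

/-- For `k ≥ 3` and `n ≥ k−1`:
`C_k(n, k−1) = C_k(n−1, k−1) + A_{k−2}(n−3, k−2) + A_{k−1}(n−3, k−2)`. -/
theorem Cseq_rec_b (k n : ℕ) (hk : 3 ≤ k) (hn : k - 1 ≤ n) :
    Cseq k k n (k-1) = Cseq k k (n-1) (k-1) + Aseq k (k-2) (n-3) (k-2) + Aseq k (k-1) (n-3) (k-2) := by
  by_cases hnk : n ≤ k
  · simp only [Cseq, Aseq]
    rw [powersetCard_Icc_eq_empty (by omega), powersetCard_Icc_eq_empty (by omega),
      powersetCard_Icc_eq_empty (by omega), powersetCard_Icc_eq_empty (by omega)]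
    simp
  obtain ⟨K, rfl⟩ : ∃ K, k = K + 3 := ⟨k - 3, by omega⟩
  obtain ⟨N, rfl⟩ : ∃ N, n = N + 3 := ⟨n - 3, by omega⟩
  simp only [show K + 3 - 1 = K + 2 by omega, show K + 3 - 2 = K + 1 by omega,
    show N + 3 - 1 = N + 2 by omega, show N + 3 - 3 = N by omega]
  rw [Cseq_eq_countLine _ _ _ _ (by omega), Cseq_eq_countLine _ _ _ _ (by omega),
    Aseq_eq_countLine _ _ _ _ (by omega), Aseq_eq_countLine _ _ _ _ (by omega),
    countLine_split _ _ (fun h => h (K + 3) = 1), countLine_not_one_two K N (by omega),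
    countLine_one_two K (N + 2) (by omega), countLine_split _ _ (fun h => h 0 = K + 1),
    countLine_first_small K N (by omega), Nat.add_comm (countLine N _)]
  congr 2
  refine countLine_congr fun h _ => ?_
  rw [and_assoc]
  refine and_congr_right fun _ => ⟨fun ⟨⟨h1, h2⟩, h3⟩ => ⟨h1, fun i hi => ?_⟩,
    fun ⟨h1, h2⟩ => ⟨⟨h1, fun i hi => ?_⟩, ?_⟩⟩
  · have := h2 0 (by omega)
    rcases Nat.eq_zero_or_pos i with rfl | hi0
    · omega
    · have := h1 0 i hi0 hi; omega
  · have := h2 i hi; omega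
  · have := h2 0 (by omega); omega
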